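/- Let d ≥ 1 be a fixed natural number, let N_n be a sequence of natural numbers tending to infinity, and for each n let A_n ⊆ [N_n]^d satisfy limsup_{n→∞} E_{a ∈ [N_n]^d} 1_{A_n}(a) ≥ δ for some δ > 0. Then there exists a ℤ^d-system (X, 𝓑, μ, (T_h)_{h ∈ ℤ^d}) and a set E ∈ 𝓑 with μ(E) ≥ δ such that for every finite list h_1, …, h_k ∈ ℤ^d one has limsup_{n→∞} E_{a ∈ [N_n]^d} 1_{A_n}(a + h_1) ⋯ 1_{A_n}(a + h_k) ≥ μ(T_{h_1} E ∩ … ∩ T_{h_k} E). -/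

import Mathlib

open Filter MeasureTheory

noncomputable section

/-- The interval `[N] = {n : ℤ | 1 ≤ n ≤ N}` as a finset of integers. -/
def intBox (N : ℕ) : Finset ℤ := Finset.Icc 1 (N : ℤ)

/-- The box `[N]^d ⊆ ℤ^d`. -/
def cube (d N : ℕ) : Finset (Fin d → ℤ) := Fintype.piFinset fun _ => intBox N

/-- The average `E_{a ∈ S} f(a) = (1/|S|) ∑_{a ∈ S} f a`. -/
def favg {α : Type*} (S : Finset α) (f : α → ℝ) : ℝ := (∑ a ∈ S, f a) / S.card

open scoped Topology

section Averages

variable {α : Type*}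

lemma favg_mem_Icc {S : Finset α} {f : α → ℝ} (hf : ∀ a, f a ∈ Set.Icc (0 : ℝ) 1) :
    favg S f ∈ Set.Icc (0 : ℝ) 1 := by
  refine ⟨div_nonneg (Finset.sum_nonneg fun a _ => (hf a).1) (Nat.cast_nonneg _),
    div_le_one_of_le₀ ?_ (Nat.cast_nonneg _)⟩
  calc ∑ a ∈ S, f a ≤ ∑ _a ∈ S, (1 : ℝ) := Finset.sum_le_sum fun a _ => (hf a).2
    _ = S.card := by simp

/-- The empirical measure of `φ` along a finite set `S`. -/
lemma exists_empirical_measure {X : Type*} [MeasurableSpace X] [Nonempty X]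
    (S : Finset α) (φ : α → X) :
    ∃ P : ProbabilityMeasure X, S.Nonempty → ∀ C : Set X, MeasurableSet C →
      ((P : Measure X) C).toReal = favg S (C.indicator 1 ∘ φ) := by
  classical
  by_cases hS : S.Nonempty
  · refine ⟨⟨((PMF.uniformOfFinset S hS).map φ).toMeasure, inferInstance⟩, fun _ C hC => ?_⟩
    let _ : MeasurableSpace α := ⊤
    rw [ProbabilityMeasure.coe_mk, PMF.toMeasure_map_apply φ _ _ measurable_from_top hC,
      PMF.toMeasure_uniformOfFinset_apply _ _ (measurable_from_top hC)]
    simp [favg, Set.indicator_apply, ENNReal.toReal_div]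
  · exact ⟨⟨Measure.dirac (Classical.arbitrary X), inferInstance⟩, fun h => absurd h hS⟩

end Averages

section Cubes

variable {d : ℕ}

lemma card_cube (d N : ℕ) : (cube d N).card = N ^ d := by
  simp [cube, intBox]

lemma cube_nonempty {N : ℕ} (hN : 1 ≤ N) : (cube d N).Nonempty := by
  rw [← Finset.card_pos, card_cube]
  positivity

/-- Shifting by a vector with entries bounded by `m` changes averages over a cube little. -/
lemma favg_cube_add_le {N m : ℕ} (hN : 1 ≤ N) (hm : 2 * m ≤ N) {h : Fin d → ℤ}
    (hh : ∀ i, |h i| ≤ m) {g : (Fin d → ℤ) → ℝ} (hg : ∀ a, g a ∈ Set.Icc (0 : ℝ) 1) :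
    favg (cube d N) (fun a => g (a + h)) ≤
      favg (cube d N) g + (1 - (((N : ℝ) - 2 * m) / N) ^ d) := by
  classical
  let I : Finset (Fin d → ℤ) := Fintype.piFinset fun _ => Finset.Icc (1 + m : ℤ) (N - m)
  have hI : (I.card : ℝ) = ((N : ℝ) - 2 * m) ^ d := by
    have : ((N : ℤ) - m + 1 - (1 + m)).toNat = N - 2 * m := by omega
    simp only [I, Fintype.card_piFinset_const, Int.card_Icc, this]
    push_cast [Nat.cast_sub hm]
    rfl
  have hIQ : I ⊆ cube d N := by
    intro a ha
    simp only [I, cube, intBox, Fintype.mem_piFinset, Finset.mem_Icc] at ha ⊢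
    intro i
    have := ha i
    omega
  have hIQh : I ⊆ (cube d N).map (addRightEmbedding h) := by
    intro a ha
    refine Finset.mem_map.2 ⟨a - h, ?_, by simp⟩
    simp only [I, cube, intBox, Fintype.mem_piFinset, Finset.mem_Icc, Pi.sub_apply] at ha ⊢
    intro i
    have := ha i
    have := abs_le.1 (hh i)
    omega
  have hN0 : (0 : ℝ) < (N : ℝ) ^ d := by positivity
  have hsum : ∑ a ∈ cube d N, g (a + h) ≤
      ∑ a ∈ cube d N, g a + ((N : ℝ) ^ d - ((N : ℝ) - 2 * m) ^ d) := by
    calc ∑ a ∈ cube d N, g (a + h)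
        = ∑ a ∈ (cube d N).map (addRightEmbedding h), g a := by simp
      _ = ∑ a ∈ (cube d N).map (addRightEmbedding h) \ I, g a + ∑ a ∈ I, g a :=
        (Finset.sum_sdiff hIQh).symm
      _ ≤ ∑ a ∈ (cube d N).map (addRightEmbedding h) \ I, (1 : ℝ) + ∑ a ∈ cube d N, g a :=
        add_le_add (Finset.sum_le_sum fun a _ => (hg a).2)
          (Finset.sum_le_sum_of_subset_of_nonneg hIQ fun a _ _ => (hg a).1)
      _ = ∑ a ∈ cube d N, g a + ((N : ℝ) ^ d - ((N : ℝ) - 2 * m) ^ d) := by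
        rw [Finset.sum_const, Finset.card_sdiff_of_subset hIQh, Finset.card_map, nsmul_one,
          Nat.cast_sub (Finset.card_le_card hIQ), hI, card_cube, Nat.cast_pow]
        ring
  have hc : ((cube d N).card : ℝ) = (N : ℝ) ^ d := by rw [card_cube, Nat.cast_pow]
  calc favg (cube d N) (fun a => g (a + h))
      ≤ (∑ a ∈ cube d N, g a + ((N : ℝ) ^ d - ((N : ℝ) - 2 * m) ^ d)) / (N : ℝ) ^ d := by
        rw [favg, hc]
        gcongr
    _ = _ := by
        rw [favg, hc, div_pow, add_div, sub_div, div_self hN0.ne']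

lemma tendsto_cube_boundary (d m : ℕ) :
    Tendsto (fun N : ℕ => 1 - (((N : ℝ) - 2 * m) / N) ^ d) atTop (𝓝 0) := by
  have h1 : Tendsto (fun N : ℕ => 1 - (1 - (2 * m : ℝ) / N) ^ d) atTop (𝓝 0) := by
    have := ((tendsto_const_div_atTop_nhds_zero_nat (2 * m : ℝ)).const_sub 1).pow d
    simpa using this.const_sub 1
  refine h1.congr' ?_
  filter_upwards [eventually_ge_atTop 1] with N hN
  have : (N : ℝ) ≠ 0 := by positivity
  rw [sub_div, div_self this]

end Cubes

/-- The limit superior of a bounded sequence is its limit along some ultrafilter. -/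
lemma exists_ultrafilter_tendsto_limsup {u : ℕ → ℝ} (hu : ∀ n, u n ∈ Set.Icc (0 : ℝ) 1) :
    ∃ U : Ultrafilter ℕ, (U : Filter ℕ) ≤ atTop ∧ Tendsto u U (𝓝 (atTop.limsup u)) := by
  have hb : IsBoundedUnder (· ≤ ·) atTop u := isBoundedUnder_of ⟨1, fun n => (hu n).2⟩
  have hb' : IsBoundedUnder (· ≥ ·) atTop u := isBoundedUnder_of ⟨0, fun n => (hu n).1⟩
  refine mapClusterPt_iff_ultrafilter.1 (mapClusterPt_iff_frequently.2 fun s hs => ?_)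
  obtain ⟨ε, hε, hs⟩ := Metric.mem_nhds_iff.1 hs
  have h1 : ∃ᶠ n in atTop, atTop.limsup u - ε < u n :=
    frequently_lt_of_lt_limsup hb'.isCoboundedUnder_flip (by linarith)
  have h2 : ∀ᶠ n in atTop, u n < atTop.limsup u + ε :=
    eventually_lt_of_limsup_lt (by linarith) hb
  refine (h1.and_eventually h2).mono fun n hn => hs ?_
  rw [Metric.mem_ball, Real.dist_eq, abs_lt]
  constructor <;> linarith [hn.1, hn.2]

/-- A limit of a bounded sequence along a nontrivial subfilter is at most the limit superior. -/
lemma le_limsup_of_tendsto {u : ℕ → ℝ} (hu : ∀ n, u n ∈ Set.Icc (0 : ℝ) 1) {l : Filter ℕ}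
    [l.NeBot] (hl : l ≤ atTop) {x : ℝ} (hx : Tendsto u l (𝓝 x)) : x ≤ atTop.limsup u := by
  rw [← hx.limsup_eq]
  exact limsup_le_limsup_of_le hl hx.isCoboundedUnder_le
    (isBoundedUnder_of ⟨1, fun n => (hu n).2⟩)

section Shift

variable {d : ℕ}

/-- The shift action of `ℤ^d` on `{0,1}^{ℤ^d}`. -/
def bshift (h : Fin d → ℤ) (x : (Fin d → ℤ) → Bool) : (Fin d → ℤ) → Bool := fun g => x (g - h)

lemma bshift_add (h h' : Fin d → ℤ) : bshift (h + h') = bshift h ∘ bshift h' := by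
  ext x g
  simp [bshift, sub_sub]

lemma bshift_zero : bshift (0 : Fin d → ℤ) = id := by
  ext x g
  simp [bshift]

lemma bshift_neg_bshift (h : Fin d → ℤ) (x : (Fin d → ℤ) → Bool) :
    bshift (-h) (bshift h x) = x := by
  rw [← Function.comp_apply (f := bshift (-h)), ← bshift_add, neg_add_cancel, bshift_zero, id]

lemma bshift_bshift_neg (h : Fin d → ℤ) (x : (Fin d → ℤ) → Bool) :
    bshift h (bshift (-h) x) = x := by
  simpa using bshift_neg_bshift (-h) x

lemma bshift_bijective (h : Fin d → ℤ) : Function.Bijective (bshift h) :=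
  Function.bijective_iff_has_inverse.2 ⟨_, bshift_neg_bshift h, bshift_bshift_neg h⟩

lemma continuous_bshift (h : Fin d → ℤ) : Continuous (bshift h) :=
  continuous_pi fun g => continuous_apply (g - h)

lemma bshift_image (h : Fin d → ℤ) :
    bshift h '' {x | x 0 = true} = {x | x h = true} := by
  rw [Set.image_eq_preimage_of_inverse (bshift_neg_bshift h) (bshift_bshift_neg h)]
  ext x
  simp [bshift]

lemma isClopen_setOf_eval (h : Fin d → ℤ) : IsClopen {x : (Fin d → ℤ) → Bool | x h = true} :=
  (isClopen_discrete {true}).preimage (continuous_apply h)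

/-- A Borel probability measure on `{0,1}^{ℤ^d}` that is not decreased by shifts of clopen sets is
shift-invariant. -/
lemma measurePreserving_bshift {μ : Measure ((Fin d → ℤ) → Bool)} [IsProbabilityMeasure μ]
    (hμ : ∀ h C, IsClopen C → μ C ≤ μ (bshift h ⁻¹' C)) (h : Fin d → ℤ) :
    MeasurePreserving (bshift h) μ μ := by
  have hmeas := (continuous_bshift h).measurable
  have := Measure.isProbabilityMeasure_map (μ := μ) hmeas.aemeasurable
  refine ⟨hmeas, ext_of_generate_finite {C | IsClopen C} ?_
    (fun s hs t ht _ => hs.inter ht) (fun C hC => ?_) (by simp)⟩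
  · rw [← isTopologicalBasis_isClopen.borel_eq_generateFrom]
    exact BorelSpace.measurable_eq
  · rw [Measure.map_apply hmeas hC.isOpen.measurableSet]
    refine le_antisymm ((hμ (-h) _ (hC.preimage (continuous_bshift h))).trans_eq ?_) (hμ h C hC)
    congr 1
    ext x
    simp [bshift_bshift_neg]

/-- The indicator of `A` translated by `a`, as a point of `{0,1}^{ℤ^d}`. -/
def translateCode (A : Finset (Fin d → ℤ)) (a : Fin d → ℤ) : (Fin d → ℤ) → Bool :=
  fun h => decide (a + h ∈ A)

lemma bshift_translateCode (A : Finset (Fin d → ℤ)) (h a : Fin d → ℤ) :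
    bshift h (translateCode A a) = translateCode A (a - h) := by
  ext g
  simp only [bshift, translateCode, add_sub, sub_add_eq_add_sub]

lemma indicator_mem_Icc {X : Type*} (C : Set X) (x : X) :
    C.indicator (1 : X → ℝ) x ∈ Set.Icc (0 : ℝ) 1 := by
  by_cases hx : x ∈ C <;> simp [hx]

/-- Along any nontrivial ultrafilter, the statistics of a sequence of finite sets in growing
cubes converge to a shift-invariant measure on `{0,1}^{ℤ^d}`. -/
lemma exists_invariant_measure {N : ℕ → ℕ} (hN : Tendsto N atTop atTop)
    (A : ℕ → Finset (Fin d → ℤ)) (U : Ultrafilter ℕ) (hU : (U : Filter ℕ) ≤ atTop) :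
    ∃ μ : Measure ((Fin d → ℤ) → Bool), IsProbabilityMeasure μ ∧
      (∀ h, MeasurePreserving (bshift h) μ μ) ∧
      ∀ C, IsClopen C → Tendsto
        (fun n => favg (cube d (N n)) (C.indicator 1 ∘ translateCode (A n))) U
        (𝓝 (μ C).toReal) := by
  choose P hP using fun n => exists_empirical_measure (cube d (N n)) (translateCode (A n))
  obtain ⟨μ, hμ⟩ : ∃ μ, Tendsto P U (𝓝 μ) := ⟨_, (U.map P).le_nhds_lim⟩
  have hNU : Tendsto N U atTop := hN.mono_left hU
  have hlim : ∀ C, IsClopen C → Tendsto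
      (fun n => favg (cube d (N n)) (C.indicator 1 ∘ translateCode (A n))) U
      (𝓝 ((μ : Measure ((Fin d → ℤ) → Bool)) C).toReal) := by
    intro C hC
    have h1 := ProbabilityMeasure.tendsto_measure_of_null_frontier_of_tendsto' hμ
      (E := C) (by simp [hC.frontier_eq])
    refine ((ENNReal.tendsto_toReal (measure_ne_top _ _)).comp h1).congr' ?_
    filter_upwards [hNU.eventually_ge_atTop 1] with n hn
    exact hP n (cube_nonempty hn) C hC.isOpen.measurableSet
  refine ⟨μ, inferInstance, measurePreserving_bshift fun h C hC => ?_, hlim⟩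
  rw [← ENNReal.toReal_le_toReal (measure_ne_top _ _) (measure_ne_top _ _)]
  obtain ⟨m, hm⟩ : ∃ m : ℕ, ∀ i, |h i| ≤ m :=
    ⟨∑ i, (h i).natAbs, fun i => by
      rw [Int.abs_eq_natAbs, Nat.cast_le]
      exact Finset.single_le_sum (f := fun i => (h i).natAbs) (fun _ _ => Nat.zero_le _)
        (Finset.mem_univ i)⟩
  have h2 := (hlim _ (hC.preimage (continuous_bshift h))).add
    ((tendsto_cube_boundary d m).comp hNU)
  rw [add_zero] at h2
  refine le_of_tendsto_of_tendsto (hlim C hC) h2 ?_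
  filter_upwards [hNU.eventually_ge_atTop 1, hNU.eventually_ge_atTop (2 * m)] with n hn hmn
  have key := favg_cube_add_le hn hmn hm
    (g := (bshift h ⁻¹' C).indicator 1 ∘ translateCode (A n)) fun a => indicator_mem_Icc _ _
  have hcode : (fun a => ((bshift h ⁻¹' C).indicator 1 ∘ translateCode (A n)) (a + h)) =
      (C.indicator 1 ∘ translateCode (A n) : _ → ℝ) := by
    classical
    funext a
    simp [Set.indicator_apply, bshift_translateCode]
  rwa [hcode] at key

end Shift

/-- **Strengthened unweighted Furstenberg correspondence principle.** Given
`A n ⊆ [N n]^d` whose upper density is at least `δ > 0`, there is a `ℤ^d`-system and a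
set `E` with `μ E ≥ δ` such that for every finite list `h₁, …, hₖ ∈ ℤ^d` one has
`limsup_n E_{a ∈ [N n]^d} 1_{A n}(a+h₁) ⋯ 1_{A n}(a+hₖ) ≥ μ (T h₁ E ∩ … ∩ T hₖ E)`.
(Indicators vanish outside `[N n]^d` since `A n ⊆ [N n]^d`.) -/
theorem unweighted_furstenberg_correspondence_strong
    (d : ℕ) (hd : 1 ≤ d) (N : ℕ → ℕ) (hN : Tendsto N atTop atTop)
    (A : ℕ → Finset (Fin d → ℤ)) (hA : ∀ n, A n ⊆ cube d (N n))
    (δ : ℝ) (hδ : 0 < δ)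
    (hdens : δ ≤ atTop.limsup fun n =>
      favg (cube d (N n)) fun a => if a ∈ A n then (1 : ℝ) else 0) :
    ∃ (X : Type) (_ : MeasurableSpace X) (μ : Measure X)
      (T : (Fin d → ℤ) → X → X) (E : Set X),
      IsProbabilityMeasure μ ∧
      (∀ h, MeasurePreserving (T h) μ μ) ∧
      (∀ h, Function.Bijective (T h)) ∧
      (∀ h h', T (h + h') = T h ∘ T h') ∧
      MeasurableSet E ∧ ENNReal.ofReal δ ≤ μ E ∧
      ∀ (k : ℕ) (h : Fin k → Fin d → ℤ),
        (μ (⋂ j, T (h j) '' E)).toReal ≤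
          atTop.limsup fun n =>
            favg (cube d (N n)) fun a =>
              ∏ j, if a + h j ∈ A n then (1 : ℝ) else 0 := by
  have hbd : ∀ n, (favg (cube d (N n)) fun a => if a ∈ A n then (1 : ℝ) else 0) ∈
      Set.Icc (0 : ℝ) 1 := fun n => favg_mem_Icc fun a => by split_ifs <;> simp
  obtain ⟨U, hU, hlim⟩ := exists_ultrafilter_tendsto_limsup hbd
  obtain ⟨μ, hμ, hinv, hμlim⟩ := exists_invariant_measure hN A U hU
  refine ⟨(Fin d → ℤ) → Bool, inferInstance, μ, bshift, {x | x 0 = true}, hμ, hinv,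
    bshift_bijective, bshift_add, (isClopen_setOf_eval 0).isOpen.measurableSet, ?_, fun k h => ?_⟩
  · have h0 := hμlim _ (isClopen_setOf_eval 0)
    simp only [Function.comp_def, Set.indicator_apply, Set.mem_ofPred_eq, translateCode, add_zero,
      decide_eq_true_eq, Pi.one_apply] at h0
    rw [tendsto_nhds_unique hlim h0] at hdens
    exact ENNReal.ofReal_le_of_le_toReal hdens
  · have h1 := hμlim (⋂ j, {x | x (h j) = true})
      (isClopen_iInter_of_finite fun j => isClopen_setOf_eval (h j))
    have hcode : ∀ n, ((⋂ j, {x | x (h j) = true}).indicator 1 ∘ translateCode (A n) : _ → ℝ) =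
        fun a => ∏ j, if a + h j ∈ A n then (1 : ℝ) else 0 := by
      classical
      intro n
      funext a
      simp [Set.indicator_apply, translateCode, Finset.prod_ite_zero]
    simp only [hcode] at h1
    simp only [bshift_image]
    refine le_limsup_of_tendsto (fun n => favg_mem_Icc fun a => ?_) hU h1
    rw [← congrFun (hcode n) a]
    exact indicator_mem_Icc _ _
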